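/- Let Λ be a finite set, let K_M ≥ 0 be a finitely supported family of constants indexed by M ∈ ℤ^Λ, and let H(φ) = −Σ_M K_M cos(M·φ). Then for every β > 0 and all M, N ∈ ℤ^Λ, the Gibbs expectation satisfies ⟨cos(M·φ) cos(N·φ)⟩ − ⟨cos(M·φ)⟩⟨cos(N·φ)⟩ ≥ 0. -/

import Mathlib

open MeasureTheory Real

/-- The box `[0, 2π]^Λ` of classical XY configurations. -/
def xyBox (Λ : Type*) [Fintype Λ] : Set (Λ → ℝ) :=
  Set.univ.pi fun _ : Λ => Set.Icc (0 : ℝ) (2 * π)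

/-- `M·φ = Σ_{x∈Λ} m_x φ_x` for `M ∈ ℤ^Λ` and `φ ∈ [0,2π]^Λ`. -/
noncomputable def zdot {Λ : Type*} [Fintype Λ] (M : Λ → ℤ) (φ : Λ → ℝ) : ℝ :=
  ∑ x : Λ, (M x : ℝ) * φ x

/-- Hamiltonian `H(φ) = −Σ_{M∈ℤ^Λ} K_M cos(M·φ)`. -/
noncomputable def cosHam {Λ : Type*} [Fintype Λ] (K : (Λ → ℤ) → ℝ) (φ : Λ → ℝ) : ℝ :=
  -∑ᶠ M : Λ → ℤ, K M * Real.cos (zdot M φ)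

/-- Gibbs expectation for the Hamiltonian `H(φ) = −Σ_M K_M cos(M·φ)` at inverse temperature
`β` (the normalisations `1/(2π)` cancel in the ratio). -/
noncomputable def cosGibbs {Λ : Type*} [Fintype Λ] (K : (Λ → ℤ) → ℝ) (β : ℝ)
    (f : (Λ → ℝ) → ℝ) : ℝ :=
  (∫ φ in xyBox Λ, f φ * Real.exp (-β * cosHam K φ)) /
  (∫ φ in xyBox Λ, Real.exp (-β * cosHam K φ))

/-- The multiplicative monoid of continuous kernels of the form `(u, v) ↦ g u * g v`. -/
def tensorSquares (X : Type*) [TopologicalSpace X] : Submonoid C(X × X, ℝ) where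
  carrier := {k | ∃ g : C(X, ℝ), ∀ p, k p = g p.1 * g p.2}
  one_mem' := ⟨1, fun p => by simp⟩
  mul_mem' := by
    rintro k l ⟨g, hg⟩ ⟨h, hh⟩
    refine ⟨g * h, fun p => ?_⟩
    simp only [ContinuousMap.mul_apply, hg, hh]
    ring

/-- The closed subsemiring of continuous kernels generated by the kernels
`(u, v) ↦ g u * g v`. -/
noncomputable def positiveKernels (X : Type*) [TopologicalSpace X] [CompactSpace X] :
    Subsemiring C(X × X, ℝ) :=
  (tensorSquares X).subsemiringClosure.topologicalClosure

section Kernels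

variable {X : Type*} [TopologicalSpace X] [CompactSpace X]

lemma mem_positiveKernels_of_eq_mul {k : C(X × X, ℝ)} (g : C(X, ℝ))
    (hk : ∀ p, k p = g p.1 * g p.2) : k ∈ positiveKernels X :=
  Subsemiring.le_topologicalClosure _ <| by
    rw [Submonoid.subsemiringClosure_eq_closure]
    exact Subsemiring.subset_closure ⟨g, hk⟩

lemma const_mem_positiveKernels {c : ℝ} (hc : 0 ≤ c) :
    ContinuousMap.const (X × X) c ∈ positiveKernels X :=
  mem_positiveKernels_of_eq_mul (ContinuousMap.const X √c) fun _ => by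
    simp [Real.mul_self_sqrt hc]

lemma exp_mem_positiveKernels {k : C(X × X, ℝ)} (hk : k ∈ positiveKernels X) :
    NormedSpace.exp k ∈ positiveKernels X := by
  refine (Subsemiring.isClosed_topologicalClosure _).mem_of_tendsto
    (NormedSpace.exp_series_hasSum_exp' (𝕂 := ℝ) k) (Filter.Eventually.of_forall fun s => ?_)
  refine sum_mem fun n _ => ?_
  have h : ((n.factorial : ℝ)⁻¹) • k ^ n =
      ContinuousMap.const (X × X) ((n.factorial : ℝ)⁻¹) * k ^ n := by
    ext p
    simp
  rw [h]
  exact mul_mem (const_mem_positiveKernels (by positivity)) (pow_mem hk n)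

lemma ContinuousMap.exp_apply_real {Y : Type*} [TopologicalSpace Y] [CompactSpace Y]
    (k : C(Y, ℝ)) (y : Y) : NormedSpace.exp k y = Real.exp (k y) := by
  rw [Real.exp_eq_exp_ℝ]
  exact NormedSpace.map_exp (ContinuousMap.evalAlgHom ℝ ℝ y) (continuous_eval_const y) k

variable [SecondCountableTopology X] [MeasurableSpace X] [BorelSpace X]

lemma integral_nonneg_of_mem_positiveKernels (μ : Measure X) [IsFiniteMeasure μ]
    {k : C(X × X, ℝ)} (hk : k ∈ positiveKernels X) : 0 ≤ ∫ p, k p ∂μ.prod μ := by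
  have hint (f : C(X × X, ℝ)) : Integrable f (μ.prod μ) :=
    f.continuous.integrable_of_hasCompactSupport (HasCompactSupport.of_compactSpace f)
  have hcl : IsClosed {f : C(X × X, ℝ) | 0 ≤ ∫ p, f p ∂μ.prod μ} :=
    isClosed_le continuous_const <|
      (continuous_integral.comp (ContinuousMap.toLp 1 (μ.prod μ) ℝ).continuous).congr fun f =>
        integral_congr_ae (ContinuousMap.coeFn_toLp (μ.prod μ) f)
  refine closure_minimal ?_ hcl hk
  intro f hf
  induction hf using AddSubmonoid.closure_induction with
  | mem f hf =>
    obtain ⟨g, hg⟩ := hf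
    simp only [Set.mem_ofPred_eq, hg]
    rw [integral_prod_mul (fun x => g x) (fun x => g x)]
    exact mul_self_nonneg _
  | zero => simp
  | add f g _ _ hf hg =>
    simp only [Set.mem_ofPred_eq, ContinuousMap.add_apply] at hf hg ⊢
    rw [integral_add (hint f) (hint g)]
    exact add_nonneg hf hg

end Kernels

section Ginibre

variable {G : Type*} [AddCommGroup G] [TopologicalSpace G] [IsTopologicalAddGroup G]
  [CompactSpace G]

lemma cos_sub_add_cos_add_mem (χ : G →+ Real.Angle) (hχ : Continuous χ) {c : ℝ} (hc : 0 ≤ c) :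
    (⟨fun p => c * ((χ (p.1 - p.2)).cos + (χ (p.1 + p.2)).cos), by
      have := Real.Angle.continuous_cos
      fun_prop⟩ : C(G × G, ℝ)) ∈ positiveKernels G := by
  refine mem_positiveKernels_of_eq_mul
    ⟨fun x => √(2 * c) * (χ x).cos, by
      have := Real.Angle.continuous_cos
      fun_prop⟩ fun p => ?_
  have h := Real.mul_self_sqrt (show 0 ≤ 2 * c by positivity)
  simp only [ContinuousMap.coe_mk, sub_eq_add_neg, map_add, map_neg, Real.Angle.cos_add,
    Real.Angle.cos_neg, Real.Angle.sin_neg]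
  linear_combination (-(χ p.1).cos * (χ p.2).cos) * h

lemma cos_sub_sub_cos_add_mem (χ : G →+ Real.Angle) (hχ : Continuous χ) :
    (⟨fun p => (χ (p.1 - p.2)).cos - (χ (p.1 + p.2)).cos, by
      have := Real.Angle.continuous_cos
      fun_prop⟩ : C(G × G, ℝ)) ∈ positiveKernels G := by
  refine mem_positiveKernels_of_eq_mul
    ⟨fun x => √2 * (χ x).sin, by
      have := Real.Angle.continuous_sin
      fun_prop⟩ fun p => ?_
  have h := Real.mul_self_sqrt (show (0 : ℝ) ≤ 2 by positivity)
  simp only [ContinuousMap.coe_mk, sub_eq_add_neg, map_add, map_neg, Real.Angle.cos_add,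
    Real.Angle.cos_neg, Real.Angle.sin_neg]
  linear_combination (-(χ p.1).sin * (χ p.2).sin) * h

variable [SecondCountableTopology G] [MeasurableSpace G] [BorelSpace G]

/-- On a compact abelian group in which every element is divisible by two, the map
`(u, v) ↦ (u - v, u + v)` preserves the square of a Haar measure. -/
lemma measurePreserving_sub_add (μ : Measure G) [μ.IsAddHaarMeasure]
    (hG : ∀ x : G, ∃ y, y + y = x) :
    MeasurePreserving (fun p : G × G => (p.1 - p.2, p.1 + p.2)) (μ.prod μ) (μ.prod μ) := by
  let f : G × G →+ G × G :=
    AddMonoidHom.prod (AddMonoidHom.fst G G - AddMonoidHom.snd G G)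
      (AddMonoidHom.fst G G + AddMonoidHom.snd G G)
  have hcont : Continuous f :=
    (continuous_fst.sub continuous_snd).prodMk (continuous_fst.add continuous_snd)
  refine AddMonoidHom.measurePreserving (f := f) hcont ?_ rfl
  rintro ⟨x, y⟩
  obtain ⟨a, rfl⟩ := hG x
  obtain ⟨b, rfl⟩ := hG y
  refine ⟨(a + b, b - a), ?_⟩
  change (a + b - (b - a), a + b + (b - a)) = _
  congr 1 <;> abel

/-- Ginibre's inequality for characters of a compact, `2`-divisible abelian group. -/
theorem ginibre_inequality (μ : Measure G) [μ.IsAddHaarMeasure]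
    (hG : ∀ x : G, ∃ y, y + y = x) {ι : Type*} (s : Finset ι) (K : ι → ℝ) (hK : ∀ i, 0 ≤ K i)
    (χ : ι → G →+ Real.Angle) (hχ : ∀ i, Continuous (χ i))
    (χ₁ χ₂ : G →+ Real.Angle) (hχ₁ : Continuous χ₁) (hχ₂ : Continuous χ₂) :
    (∫ x, (χ₁ x).cos * Real.exp (∑ i ∈ s, K i * (χ i x).cos) ∂μ) *
        (∫ x, (χ₂ x).cos * Real.exp (∑ i ∈ s, K i * (χ i x).cos) ∂μ) ≤
      (∫ x, (χ₁ x).cos * (χ₂ x).cos * Real.exp (∑ i ∈ s, K i * (χ i x).cos) ∂μ) *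
        ∫ x, Real.exp (∑ i ∈ s, K i * (χ i x).cos) ∂μ := by
  have hcos := Real.Angle.continuous_cos
  set c₁ : G → ℝ := fun x => (χ₁ x).cos with hc₁
  set c₂ : G → ℝ := fun x => (χ₂ x).cos with hc₂
  set w : G → ℝ := fun x => Real.exp (∑ i ∈ s, K i * (χ i x).cos) with hw
  have c₁_cont : Continuous c₁ := by fun_prop
  have c₂_cont : Continuous c₂ := by fun_prop
  have w_cont : Continuous w := by fun_prop
  have hint {f : G → ℝ} (hf : Continuous f) : Integrable f μ :=
    hf.integrable_of_hasCompactSupport (HasCompactSupport.of_compactSpace f)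
  have key : 0 ≤ ∫ p : G × G,
      (c₁ p.1 - c₁ p.2) * (c₂ p.1 - c₂ p.2) * (w p.1 * w p.2) ∂μ.prod μ := by
    have hT := measurePreserving_sub_add μ hG
    rw [← hT.map_eq, integral_map hT.measurable.aemeasurable
      (Continuous.aestronglyMeasurable (by fun_prop))]
    have hmem := mul_mem
      (mul_mem (cos_sub_sub_cos_add_mem χ₁ hχ₁) (cos_sub_sub_cos_add_mem χ₂ hχ₂))
      (exp_mem_positiveKernels
        (sum_mem fun i (_ : i ∈ s) => cos_sub_add_cos_add_mem (χ i) (hχ i) (hK i)))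
    convert integral_nonneg_of_mem_positiveKernels μ hmem using 3 with p
    simp only [hc₁, hc₂, hw, ContinuousMap.mul_apply, ContinuousMap.exp_apply_real,
      ContinuousMap.coe_mk, ContinuousMap.sum_apply, ← Real.exp_add, ← Finset.sum_add_distrib,
      mul_add]
  have expand : ∫ p : G × G,
      (c₁ p.1 - c₁ p.2) * (c₂ p.1 - c₂ p.2) * (w p.1 * w p.2) ∂μ.prod μ =
      2 * ((∫ x, c₁ x * c₂ x * w x ∂μ) * (∫ x, w x ∂μ) -
        (∫ x, c₁ x * w x ∂μ) * ∫ x, c₂ x * w x ∂μ) := by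
    have i₀ : Integrable w μ := hint w_cont
    have i₁ : Integrable (fun x => c₁ x * w x) μ := hint (by fun_prop)
    have i₂ : Integrable (fun x => c₂ x * w x) μ := hint (by fun_prop)
    have i₃ : Integrable (fun x => c₁ x * c₂ x * w x) μ := hint (by fun_prop)
    calc _ = ∫ p : G × G, ((c₁ p.1 * c₂ p.1 * w p.1) * w p.2 +
            w p.1 * (c₁ p.2 * c₂ p.2 * w p.2)) -
            ((c₁ p.1 * w p.1) * (c₂ p.2 * w p.2) +
              (c₂ p.1 * w p.1) * (c₁ p.2 * w p.2)) ∂μ.prod μ := by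
          congr 1 with p
          ring
      _ = _ := by
          rw [integral_sub ((i₃.mul_prod i₀).fun_add (i₀.mul_prod i₃))
              ((i₁.mul_prod i₂).fun_add (i₂.mul_prod i₁)),
            integral_add (i₃.mul_prod i₀) (i₀.mul_prod i₃),
            integral_add (i₁.mul_prod i₂) (i₂.mul_prod i₁),
            integral_prod_mul (fun x => c₁ x * c₂ x * w x) w,
            integral_prod_mul w (fun x => c₁ x * c₂ x * w x),
            integral_prod_mul (fun x => c₁ x * w x) (fun x => c₂ x * w x),
            integral_prod_mul (fun x => c₂ x * w x) (fun x => c₁ x * w x)]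
          ring
  linarith

end Ginibre

section Torus

variable {Λ : Type*} [Fintype Λ]

/-- The integral over `[0, 2π]^Λ` of a function on the torus. -/
lemma setIntegral_xyBox_eq_integral_torus {f : (Λ → AddCircle (2 * π)) → ℝ}
    (hf : Continuous f) :
    haveI : Fact (0 < 2 * π) := ⟨Real.two_pi_pos⟩
    ∫ φ in xyBox Λ, f (fun x => (φ x : AddCircle (2 * π))) = ∫ θ, f θ := by
  have : Fact (0 < 2 * π) := ⟨Real.two_pi_pos⟩
  have hbox : (volume : Measure (Λ → ℝ)).restrict (xyBox Λ) =
      Measure.pi fun _ : Λ => (volume : Measure ℝ).restrict (Set.Ioc 0 (0 + 2 * π)) := by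
    simp_rw [xyBox, zero_add, volume_pi, Measure.restrict_pi_pi, restrict_Ioc_eq_restrict_Icc]
  have hmp := measurePreserving_pi _ _
    fun _ : Λ => AddCircle.measurePreserving_mk (2 * π) 0
  rw [hbox, volume_pi, ← hmp.map_eq,
    integral_map hmp.measurable.aemeasurable hf.aestronglyMeasurable]

/-- The character `θ ↦ M·θ` of the torus, with values in the additive group of angles. -/
noncomputable def torusCharacter (M : Λ → ℤ) : (Λ → AddCircle (2 * π)) →+ Real.Angle where
  toFun θ := ∑ x, M x • (θ x : Real.Angle)
  map_zero' := Finset.sum_eq_zero fun x _ => smul_zero (A := Real.Angle) (M x)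
  map_add' θ η := by
    exact (Finset.sum_congr rfl fun x _ => smul_add (A := Real.Angle) (M x) _ _).trans
      Finset.sum_add_distrib

lemma continuous_torusCharacter (M : Λ → ℤ) : Continuous (torusCharacter M) :=
  continuous_finsetSum (M := Real.Angle) _ fun x _ =>
    (continuous_zsmul (G := Real.Angle) (M x)).comp (continuous_apply x)

lemma cos_torusCharacter_coe (M : Λ → ℤ) (φ : Λ → ℝ) :
    (torusCharacter M fun x => (φ x : AddCircle (2 * π))).cos = Real.cos (zdot M φ) := by
  rw [← Real.Angle.cos_coe]
  congr 1
  change ∑ x, M x • (φ x : Real.Angle) = Real.Angle.coeHom (zdot M φ)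
  simp [zdot, map_sum]

end Torus

/-- For the Hamiltonian `H(φ) = −Σ_M K_M cos(M·φ)` with `K_M ≥ 0` finitely supported, the
truncated correlation of two cosines is nonnegative:
`⟨cos(M·φ) cos(N·φ)⟩ − ⟨cos(M·φ)⟩⟨cos(N·φ)⟩ ≥ 0`. -/
theorem cos_gibbs_truncated_nonneg {Λ : Type*} [Fintype Λ]
    (K : (Λ → ℤ) → ℝ) (hK_fin : (Function.support K).Finite)
    (hK_nonneg : ∀ M : Λ → ℤ, 0 ≤ K M)
    (β : ℝ) (hβ : 0 < β) (M N : Λ → ℤ) :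
    0 ≤ cosGibbs K β (fun φ => Real.cos (zdot M φ) * Real.cos (zdot N φ)) -
        cosGibbs K β (fun φ => Real.cos (zdot M φ)) *
          cosGibbs K β (fun φ => Real.cos (zdot N φ)) := by
  have : Fact (0 < 2 * π) := ⟨Real.two_pi_pos⟩
  have hcos := Real.Angle.continuous_cos
  have hχ := continuous_torusCharacter (Λ := Λ)
  let w : (Λ → AddCircle (2 * π)) → ℝ := fun θ =>
    Real.exp (∑ L ∈ hK_fin.toFinset, β * K L * (torusCharacter L θ).cos)
  have w_cont : Continuous w := by fun_prop
  have hw (φ : Λ → ℝ) :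
      Real.exp (-β * cosHam K φ) = w fun x => (φ x : AddCircle (2 * π)) := by
    simp only [w, cos_torusCharacter_coe, cosHam]
    rw [finsum_eq_sum_of_support_subset (s := hK_fin.toFinset) _ fun L hL => by
      simpa using left_ne_zero_of_mul hL, neg_mul_neg, Finset.mul_sum]
    simp only [mul_assoc]
  have hdiv (θ : Λ → AddCircle (2 * π)) : ∃ η, η + η = θ := by
    choose η hη using fun x => DivisibleBy.surjective_smul (AddCircle (2 * π)) ℤ two_ne_zero (θ x)
    exact ⟨η, funext fun x => by simpa [two_smul] using hη x⟩
  have h := ginibre_inequality volume hdiv hK_fin.toFinset (fun L => β * K L)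
    (fun L => mul_nonneg hβ.le (hK_nonneg L)) torusCharacter hχ
    (torusCharacter M) (torusCharacter N) (hχ M) (hχ N)
  have hZ : 0 < ∫ θ, w θ := integral_exp_pos
    (w_cont.integrable_of_hasCompactSupport (HasCompactSupport.of_compactSpace w))
  simp only [cosGibbs, hw, ← cos_torusCharacter_coe]
  rw [setIntegral_xyBox_eq_integral_torus w_cont,
    setIntegral_xyBox_eq_integral_torus
      (f := fun θ => (torusCharacter M θ).cos * (torusCharacter N θ).cos * w θ) (by fun_prop),
    setIntegral_xyBox_eq_integral_torus
      (f := fun θ => (torusCharacter M θ).cos * w θ) (by fun_prop),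
    setIntegral_xyBox_eq_integral_torus
      (f := fun θ => (torusCharacter N θ).cos * w θ) (by fun_prop),
    div_mul_div_comm, sub_nonneg, div_le_div_iff₀ (mul_pos hZ hZ) hZ, ← mul_assoc]
  exact mul_le_mul_of_nonneg_right h hZ.le
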